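/- arXiv:2303.01682 — 7 statements merged into one kernel-verified Lean document; each statement's English description precedes it below -/
import Mathlib

section
/- Let p ≥ 1 and T ≥ 1 be natural numbers, let λ ≥ 1 and B > 0 be real numbers, and let v₁, …, v_T ∈ ℝ^p. For 0 ≤ t ≤ T define V_t = λ·I_p + Σ_{i=1}^{t} v_i v_iᵀ (so V_0 = λ·I_p). Then Σ_{t=1}^{T} min{ v_tᵀ V_{t-1}⁻¹ v_t , B } ≤ (B / log(B+1)) · log det( I_p + λ⁻¹ Σ_{i=1}^{T} v_i v_iᵀ ), where log denotes the natural logarithm. -/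
open Matrix Finset

lemma aux_scalar (x B : ℝ) (hx : 0 ≤ x) (hB : 0 < B) :
    min x B ≤ (B / Real.log (B + 1)) * Real.log (1 + x) := by
  have hm0 : 0 ≤ min x B := le_min hx hB.le
  have hmB : min x B ≤ B := min_le_right _ _
  have hL : 0 < Real.log (B + 1) := Real.log_pos (by linarith)
  have h1 : (1 + B) ^ (min x B / B) ≤ 1 + (min x B / B) * B :=
    rpow_one_add_le_one_add_mul_self (by linarith) (by positivity)
      ((div_le_one hB).2 hmB)
  rw [div_mul_cancel₀ _ hB.ne'] at h1
  have h2 : (1 + B) ^ (min x B / B) ≤ 1 + x := h1.trans (by linarith [min_le_left x B])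
  have h3 := Real.log_le_log (by positivity) h2
  rw [Real.log_rpow (by linarith), add_comm 1 B] at h3
  calc min x B = (B / Real.log (B + 1)) * (min x B / B * Real.log (B + 1)) := by
        field_simp
    _ ≤ _ := mul_le_mul_of_nonneg_left h3 (by positivity)

lemma aux_det {p : ℕ} (A : Matrix (Fin p) (Fin p) ℝ) (hA : IsUnit A.det) (u : Fin p → ℝ) :
    (A + vecMulVec u u).det = A.det * (1 + u ⬝ᵥ A⁻¹ *ᵥ u) := by
  have h := det_add_replicateCol_mul_replicateRow (ι := Unit) hA u u
  rw [vecMulVec_eq Unit, h]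
  congr 1
  rw [det_unique]
  simp [Matrix.mul_assoc, Matrix.mul_apply, dotProduct, mulVec, replicateRow, replicateCol]

/-- Elliptical potential lemma: the sum of truncated quadratic forms is bounded by a
log-determinant. -/
theorem stmt_0 (p T : ℕ) (hp : 1 ≤ p) (hT : 1 ≤ T) (lam B : ℝ) (hlam : 1 ≤ lam)
    (hB : 0 < B) (v : ℕ → (Fin p → ℝ))
    (V : ℕ → Matrix (Fin p) (Fin p) ℝ)
    (hV : ∀ t, V t = lam • (1 : Matrix (Fin p) (Fin p) ℝ) +
      ∑ i ∈ Finset.range t, vecMulVec (v i) (v i)) :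
    ∑ t ∈ Finset.range T, min (v t ⬝ᵥ (V t)⁻¹ *ᵥ v t) B ≤
      (B / Real.log (B + 1)) *
        Real.log (Matrix.det ((1 : Matrix (Fin p) (Fin p) ℝ) +
          lam⁻¹ • ∑ i ∈ Finset.range T, vecMulVec (v i) (v i))) := by
  have hl : 0 < lam := by linarith
  have hpd : ∀ t, (V t).PosDef := by
    intro t
    rw [hV]
    refine Matrix.PosDef.add_posSemidef (Matrix.PosDef.one.smul hl)
      (Matrix.posSemidef_sum _ fun i _ => ?_)
    simpa using posSemidef_vecMulVec_self_star (v i)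
  have hx : ∀ t, 0 ≤ v t ⬝ᵥ (V t)⁻¹ *ᵥ v t := fun t => by
    simpa using (hpd t).inv.posSemidef.dotProduct_mulVec_nonneg (v t)
  have hstep : ∀ t, (V (t+1)).det = (V t).det * (1 + v t ⬝ᵥ (V t)⁻¹ *ᵥ v t) := by
    intro t
    rw [← aux_det _ (hpd t).det_pos.ne'.isUnit, hV (t+1), sum_range_succ, ← add_assoc, ← hV t]
  have key : ∀ n, ∑ t ∈ Finset.range n, min (v t ⬝ᵥ (V t)⁻¹ *ᵥ v t) B ≤
      (B / Real.log (B + 1)) * (Real.log (V n).det - Real.log (V 0).det) := by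
    intro n
    induction n with
    | zero => simp
    | succ n ih =>
      rw [sum_range_succ, hstep, Real.log_mul (hpd n).det_pos.ne' (by linarith [hx n])]
      have := aux_scalar _ B (hx n) hB
      linarith
  refine (key T).trans (le_of_eq ?_)
  congr 1
  have hA : (1 : Matrix (Fin p) (Fin p) ℝ) +
          lam⁻¹ • ∑ i ∈ Finset.range T, vecMulVec (v i) (v i) = lam⁻¹ • V T := by
    rw [hV, smul_add, smul_smul, inv_mul_cancel₀ hl.ne', one_smul]
  have h0 : (V 0).det = lam ^ p := by
    rw [hV]; simp [det_smul]
  rw [hA, det_smul, h0, Fintype.card_fin, Real.log_mul (by positivity) (hpd T).det_pos.ne',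
    inv_pow, Real.log_inv]
  ring
end

section
/- Let p ≥ 1 and T ≥ 1 be natural numbers, let λ > 0 be a real number, and let v₁, …, v_T ∈ ℝ^p. For 0 ≤ t ≤ T define V_t = λ·I_p + Σ_{i=1}^{t} v_i v_iᵀ (so V_0 = λ·I_p). Then det(V_T) = λ^p · Π_{t=1}^{T} ( 1 + v_tᵀ V_{t-1}⁻¹ v_t ). -/
open Matrix Finset

/-- Determinant product formula for the elliptical potential matrices. -/
theorem stmt_1 (p T : ℕ) (hp : 1 ≤ p) (hT : 1 ≤ T) (lam : ℝ) (hlam : 0 < lam)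
    (v : ℕ → (Fin p → ℝ))
    (V : ℕ → Matrix (Fin p) (Fin p) ℝ)
    (hV : ∀ t, V t = lam • (1 : Matrix (Fin p) (Fin p) ℝ) +
      ∑ i ∈ Finset.range t, vecMulVec (v i) (v i)) :
    Matrix.det (V T) = lam ^ p * ∏ t ∈ Finset.range T, (1 + v t ⬝ᵥ (V t)⁻¹ *ᵥ v t) := by
  have hpd : ∀ t, (V t).PosDef := by
    intro t
    rw [hV t]
    refine (Matrix.PosDef.one.smul hlam).add_posSemidef ?_
    refine Matrix.posSemidef_sum _ fun i _ => ?_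
    simpa using Matrix.posSemidef_vecMulVec_self_star (v i)
  clear hT
  induction T with
  | zero => simp [hV]
  | succ t ih =>
    have hu : IsUnit (V t).det := (hpd t).det_pos.ne'.isUnit
    have h1 : V (t + 1) = V t + vecMulVec (v t) (v t) := by
      rw [hV, hV t, Finset.sum_range_succ, add_assoc]
    have h2 : V (t + 1) = V t * (1 + replicateCol Unit ((V t)⁻¹ *ᵥ v t) *
        replicateRow Unit (v t)) := by
      rw [h1, ← vecMulVec_eq, Matrix.mul_add, mul_one, mul_vecMulVec, mulVec_mulVec,
        Matrix.mul_nonsing_inv _ hu, one_mulVec]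
    rw [h2, det_mul, det_one_add_replicateCol_mul_replicateRow, ih, Finset.prod_range_succ,
      mul_assoc]
end

section
/- Let B > 0 be a real number and let u be a real number with 0 ≤ u ≤ B. Then min{u, B} ≤ (B / log(B+1)) · log(1+u), where log denotes the natural logarithm. -/
/-- Elementary inequality: `min u B ≤ (B / log (B+1)) * log (1+u)` for `0 ≤ u ≤ B`. -/
theorem stmt_2 (B u : ℝ) (hB : 0 < B) (hu0 : 0 ≤ u) (huB : u ≤ B) :
    min u B ≤ (B / Real.log (B + 1)) * Real.log (1 + u) := by
  have hL : 0 < Real.log (B + 1) := Real.log_pos (by linarith)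
  have h1 : B + 1 ∈ Set.Ioi (0 : ℝ) := Set.mem_Ioi.2 (by linarith)
  have h2 : (1 : ℝ) ∈ Set.Ioi (0 : ℝ) := Set.mem_Ioi.2 one_pos
  have ha : 0 ≤ u / B := by positivity
  have hb : 0 ≤ 1 - u / B := sub_nonneg.2 ((div_le_one hB).2 huB)
  have h := strictConcaveOn_log_Ioi.concaveOn.2 h1 h2 ha hb (by ring)
  have e : u / B * (B + 1) + (1 - u / B) * 1 = 1 + u := by
    field_simp
    ring
  simp only [smul_eq_mul, Real.log_one, mul_zero, add_zero] at h
  rw [e, div_mul_eq_mul_div, div_le_iff₀ hB] at h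
  rw [min_eq_left huB, div_mul_eq_mul_div, le_div_iff₀ hL]
  linarith
end

section
/- Let t ≥ 1 be a natural number, let λ ≥ 1 and ε ≥ 0 be real numbers, and let H and K be real symmetric positive semidefinite t×t matrices whose entries satisfy |K_{ij} − H_{ij}| ≤ ε for all i, j. Then log det( I_t + λ⁻¹·K ) ≤ log det( I_t + λ⁻¹·H ) + t^{3/2}·ε. -/
open Matrix

lemma aux_det_s10 {n : Type*} [Fintype n] [DecidableEq n] (M : Matrix n n ℝ) (hM : M.PosDef) :
    Real.log M.det ≤ M.trace - Fintype.card n := by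
  rw [hM.1.det_eq_prod_eigenvalues, hM.1.trace_eq_sum_eigenvalues]
  simp only [RCLike.ofReal_real_eq_id, id]
  rw [Real.log_prod (fun i _ => (hM.eigenvalues_pos i).ne')]
  have : ∑ i, hM.1.eigenvalues i - (Fintype.card n : ℝ) = ∑ i, (hM.1.eigenvalues i - 1) := by
    simp
  rw [this]
  exact Finset.sum_le_sum fun i _ => Real.log_le_sub_one_of_pos (hM.eigenvalues_pos i)

open scoped MatrixOrder in
lemma aux_fac {n : Type*} [Fintype n] [DecidableEq n] (B : Matrix n n ℝ) (hB : B.PosSemidef) :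
    ∃ C : Matrix n n ℝ, B = Cᴴ * C :=
  CStarAlgebra.nonneg_iff_eq_star_mul_self.mp hB.nonneg

lemma aux_logdet {n : Type*} [Fintype n] [DecidableEq n] (A B : Matrix n n ℝ)
    (hA : A.PosDef) (hB : B.PosDef) :
    Real.log A.det ≤ Real.log B.det + ((A - B) * B⁻¹).trace := by
  obtain ⟨C, hC⟩ := aux_fac B⁻¹ hB.inv.posSemidef
  have hBu : IsUnit B.det := (isUnit_iff_isUnit_det _).mp hB.isUnit
  have hdet : B.det * (C.det * C.det) = 1 := by
    have h := congrArg det (mul_nonsing_inv B hBu)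
    rw [hC] at h
    simpa [det_conjTranspose] using h
  have hpos := hA.det_pos
  have hBpos := hB.det_pos
  have hM0 := hA.posSemidef.mul_mul_conjTranspose_same C
  have hMdet : (C * A * Cᴴ).det * B.det = A.det := by
    simp only [det_mul, det_conjTranspose, star_trivial]
    linear_combination A.det * hdet
  have hne : (C * A * Cᴴ).det ≠ 0 := by
    intro h
    rw [h] at hMdet
    linarith
  have hM : (C * A * Cᴴ).PosDef := hM0.posDef_iff_det_ne_zero.mpr hne
  have h1 := aux_det_s10 _ hM
  rw [Matrix.mul_assoc, trace_mul_comm, Matrix.mul_assoc, ← hC, ← Matrix.mul_assoc] at h1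
  rw [← hMdet, Real.log_mul hne hBpos.ne', sub_mul, mul_nonsing_inv B hBu, trace_sub, trace_one]
  linarith

lemma aux_inv {n : Type*} [Fintype n] [DecidableEq n] (H P : Matrix n n ℝ)
    (hH : H.PosSemidef) (hP : (1 + H) * P = 1) (j : n) : ∑ i, P i j ^ 2 ≤ 1 := by
  have h1 := hH.dotProduct_mulVec_nonneg (fun i => P i j)
  have h2 : (1 + H) *ᵥ (fun i => P i j) = fun i => (1 : Matrix n n ℝ) i j := by
    funext i
    exact congrFun (congrFun hP i) j
  rw [add_mulVec, one_mulVec] at h2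
  have h3 : (fun i => P i j) ⬝ᵥ ((fun i => P i j) + H *ᵥ (fun i => P i j)) = P j j := by
    rw [h2]; simp [dotProduct, one_apply]
  rw [dotProduct_add] at h3
  have h4 : (fun i => P i j) ⬝ᵥ (fun i => P i j) = ∑ i, P i j ^ 2 := by
    simp [dotProduct, sq]
  have h5 : P j j ^ 2 ≤ ∑ i, P i j ^ 2 :=
    Finset.single_le_sum (f := fun i => P i j ^ 2) (fun i _ => sq_nonneg _) (Finset.mem_univ j)
  simp only [star_trivial] at h1
  nlinarith

/-- Log-determinant perturbation bound for entrywise-close positive semidefinite matrices. -/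
theorem stmt_10 (t : ℕ) (ht : 1 ≤ t) (lam ε : ℝ) (hlam : 1 ≤ lam) (hε : 0 ≤ ε)
    (H K : Matrix (Fin t) (Fin t) ℝ) (hH : H.PosSemidef) (hK : K.PosSemidef)
    (hclose : ∀ i j, |K i j - H i j| ≤ ε) :
    Real.log (Matrix.det ((1 : Matrix (Fin t) (Fin t) ℝ) + lam⁻¹ • K)) ≤
      Real.log (Matrix.det ((1 : Matrix (Fin t) (Fin t) ℝ) + lam⁻¹ • H)) +
        (t : ℝ) ^ ((3 : ℝ) / 2) * ε := by
  have hl : 0 ≤ lam⁻¹ := by positivity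
  have hl1 : lam⁻¹ ≤ 1 := inv_le_one_of_one_le₀ hlam
  have hH' : (lam⁻¹ • H).PosSemidef := hH.smul hl
  have hK' : (lam⁻¹ • K).PosSemidef := hK.smul hl
  have hA := (PosDef.one (n := Fin t) (R := ℝ)).add_posSemidef hK'
  have hB := (PosDef.one (n := Fin t) (R := ℝ)).add_posSemidef hH'
  refine (aux_logdet _ _ hA hB).trans ?_
  gcongr
  have hP := aux_inv _ _ hH' (mul_nonsing_inv _ ((isUnit_iff_isUnit_det _).mp hB.isUnit))
  set P := (1 + lam⁻¹ • H)⁻¹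
  have e1 : ((1 + lam⁻¹ • K - (1 + lam⁻¹ • H)) * P).trace
      = ∑ i, ∑ j, lam⁻¹ * (K i j - H i j) * P j i := by
    simp only [trace, diag, mul_apply]
    refine Finset.sum_congr rfl fun i _ => Finset.sum_congr rfl fun j _ => ?_
    simp; left; ring
  have e2 : ∀ i, ∑ j, lam⁻¹ * (K i j - H i j) * P j i ≤ ε * Real.sqrt t := by
    intro i
    have c : ∑ j, |P j i| ≤ Real.sqrt t := by
      apply Real.le_sqrt_of_sq_le
      have := sq_sum_le_card_mul_sum_sq (s := Finset.univ) (f := fun j => |P j i|)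
      simp only [sq_abs, Finset.card_univ, Fintype.card_fin] at this
      have := hP i
      have : (0:ℝ) ≤ t := by positivity
      nlinarith
    calc _ ≤ ∑ j, ε * |P j i| := by
          refine Finset.sum_le_sum fun j _ => ?_
          refine (le_abs_self _).trans ?_
          rw [abs_mul, abs_mul, abs_of_nonneg hl]
          gcongr
          have := hclose i j
          nlinarith [abs_nonneg (K i j - H i j)]
      _ = ε * ∑ j, |P j i| := by rw [Finset.mul_sum]
      _ ≤ _ := by gcongr
  rw [e1]
  refine (Finset.sum_le_sum fun i _ => e2 i).trans ?_
  have ht0 : (0:ℝ) < t := by exact_mod_cast ht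
  rw [show (3:ℝ)/2 = 1 + 1/2 by norm_num, Real.rpow_add ht0, Real.rpow_one, ← Real.sqrt_eq_rpow]
  simp
  apply le_of_eq; ring
end

section
/- Let μ ∈ ℝ, s > 0, ε ≥ 0, and v ∈ ℝ with v − μ ≤ s + ε. Let X be a real-valued random variable distributed according to N(μ, s²). Then P( X + ε > v ) ≥ 1/(4e√π). -/
open MeasureTheory ProbabilityTheory

/-- A Thompson sample exceeds the true value (up to the approximation error `ε`)
with probability at least `1/(4e√π)`. -/
theorem stmt_12 {Ω : Type*} [MeasurableSpace Ω] (P : Measure Ω) [IsProbabilityMeasure P]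
    (μ s ε v : ℝ) (hs : 0 < s) (hε : 0 ≤ ε) (hv : v - μ ≤ s + ε) (X : Ω → ℝ)
    (hX : P.map X = gaussianReal μ ⟨s ^ 2, sq_nonneg s⟩) :
    ENNReal.ofReal (1 / (4 * Real.exp 1 * Real.sqrt Real.pi)) ≤ P {ω | v < X ω + ε} := by
  obtain ⟨w, hw, hX⟩ : ∃ w : NNReal, (w : ℝ) = s ^ 2 ∧ P.map X = gaussianReal μ w :=
    ⟨_, rfl, hX⟩
  have hXm : AEMeasurable X P := by
    by_contra h
    rw [Measure.map_of_not_aemeasurable h] at hX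
    exact IsProbabilityMeasure.ne_zero (gaussianReal μ w) hX.symm
  have hvar : w ≠ 0 := by
    intro h
    have h2 : s ^ 2 = 0 := by rw [← hw, h]; rfl
    exact (pow_pos hs 2).ne' h2
  have hsp : 0 < Real.sqrt Real.pi := Real.sqrt_pos.mpr Real.pi_pos
  have he : 0 < Real.exp 1 := Real.exp_pos 1
  have hsub : X ⁻¹' (Set.Ioc (μ + s) (μ + 7 / 5 * s)) ⊆ {ω | v < X ω + ε} := by
    intro ω hω
    have h1 : μ + s < X ω := hω.1
    show v < X ω + ε
    linarith
  refine le_trans ?_ (measure_mono hsub)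
  rw [← Measure.map_apply_of_aemeasurable hXm measurableSet_Ioc, hX, gaussianReal_apply _ hvar]
  have hpdf : ∀ x ∈ Set.Ioc (μ + s) (μ + 7 / 5 * s),
      ENNReal.ofReal (1 / (8 / 5 * s * Real.sqrt Real.pi) * (Real.exp 1)⁻¹)
        ≤ gaussianPDF μ w x := by
    intro x hx
    rw [gaussianPDF_def, gaussianPDFReal_def]
    apply ENNReal.ofReal_le_ofReal
    simp only [hw]
    change _ ≤ (Real.sqrt (2 * Real.pi * s ^ 2))⁻¹ * Real.exp (-(x - μ) ^ 2 / (2 * s ^ 2))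
    have h1 : (1 / (8 / 5 * s * Real.sqrt Real.pi)) ≤ (Real.sqrt (2 * Real.pi * s ^ 2))⁻¹ := by
      rw [one_div]
      have hpos : 0 < Real.sqrt (2 * Real.pi * s ^ 2) := Real.sqrt_pos.mpr (by positivity)
      apply inv_anti₀ hpos
      apply Real.sqrt_le_iff.mpr
      refine ⟨by positivity, ?_⟩
      rw [mul_pow, Real.sq_sqrt Real.pi_pos.le]
      have : 0 < Real.pi * s ^ 2 := by positivity
      nlinarith
    have h2 : (Real.exp 1)⁻¹ ≤ Real.exp (-(x - μ) ^ 2 / (2 * s ^ 2)) := by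
      rw [← Real.exp_neg]
      apply Real.exp_le_exp.mpr
      rw [le_div_iff₀ (by positivity)]
      have h3 := hx.1
      have h4 := hx.2
      nlinarith
    exact mul_le_mul h1 h2 (by positivity) (by positivity)
  calc ENNReal.ofReal (1 / (4 * Real.exp 1 * Real.sqrt Real.pi))
      = ENNReal.ofReal (1 / (8 / 5 * s * Real.sqrt Real.pi) * (Real.exp 1)⁻¹)
        * volume (Set.Ioc (μ + s) (μ + 7 / 5 * s)) := by
        rw [Real.volume_Ioc, ← ENNReal.ofReal_mul (by positivity)]
        congr 1
        field_simp
        ring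
    _ = ∫⁻ _ in Set.Ioc (μ + s) (μ + 7 / 5 * s),
        ENNReal.ofReal (1 / (8 / 5 * s * Real.sqrt Real.pi) * (Real.exp 1)⁻¹) := by
        rw [setLIntegral_const]
    _ ≤ _ := setLIntegral_mono' measurableSet_Ioc hpdf
end

section
/- Let p, t ≥ 1 be natural numbers, λ > 0 and m > 0 real numbers, G a real p×t matrix, and g, w ∈ ℝ^p. Define U = λ·I_p + (1/m)·G·Gᵀ. Then gᵀ w − (1/m)·gᵀ U⁻¹ G Gᵀ w = λ·gᵀ U⁻¹ w, and moreover | λ·gᵀ U⁻¹ w | ≤ ‖w‖₂ · √( λ·gᵀ U⁻¹ g ). -/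
open Matrix

/-- Bias identity and bound for the kernel ridge regression estimate. -/
theorem stmt_14 (p t : ℕ) (hp : 1 ≤ p) (ht : 1 ≤ t) (lam m : ℝ) (hlam : 0 < lam)
    (hm : 0 < m) (G : Matrix (Fin p) (Fin t) ℝ) (g w : Fin p → ℝ)
    (U : Matrix (Fin p) (Fin p) ℝ)
    (hU : U = lam • (1 : Matrix (Fin p) (Fin p) ℝ) + (1 / m) • (G * Gᵀ)) :
    (g ⬝ᵥ w - (1 / m) * (g ⬝ᵥ U⁻¹ *ᵥ (G *ᵥ (Gᵀ *ᵥ w))) = lam * (g ⬝ᵥ U⁻¹ *ᵥ w)) ∧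
    (|lam * (g ⬝ᵥ U⁻¹ *ᵥ w)|
        ≤ Real.sqrt (∑ i, (w i) ^ 2) * Real.sqrt (lam * (g ⬝ᵥ U⁻¹ *ᵥ g))) := by
  have hUv : ∀ v : Fin p → ℝ, U *ᵥ v = lam • v + (1 / m) • (G *ᵥ (Gᵀ *ᵥ v)) := by
    intro v
    rw [hU, add_mulVec, smul_mulVec, smul_mulVec, one_mulVec, mulVec_mulVec]
  have hq : ∀ v : Fin p → ℝ, lam * (v ⬝ᵥ v) ≤ v ⬝ᵥ U *ᵥ v := by
    intro v
    have h1 : v ⬝ᵥ G *ᵥ (Gᵀ *ᵥ v) = (Gᵀ *ᵥ v) ⬝ᵥ (Gᵀ *ᵥ v) := by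
      rw [dotProduct_mulVec, ← mulVec_transpose]
    have h2 : 0 ≤ (Gᵀ *ᵥ v) ⬝ᵥ (Gᵀ *ᵥ v) :=
      Finset.sum_nonneg fun i _ => mul_self_nonneg _
    rw [hUv, dotProduct_add, dotProduct_smul, dotProduct_smul, h1, smul_eq_mul, smul_eq_mul]
    have : 0 ≤ (1 / m) * ((Gᵀ *ᵥ v) ⬝ᵥ (Gᵀ *ᵥ v)) := by positivity
    linarith
  have hsym : Uᵀ = U := by
    rw [hU]; simp [transpose_add, transpose_smul, transpose_mul]
  have hdet : IsUnit U.det := by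
    rw [isUnit_iff_ne_zero]
    intro h0
    obtain ⟨v, hv, hv0⟩ := exists_mulVec_eq_zero_iff.mpr h0
    have h1 := hq v
    rw [hv0, dotProduct_zero] at h1
    have h2 : 0 ≤ v ⬝ᵥ v := Finset.sum_nonneg fun i _ => mul_self_nonneg _
    have h3 : v ⬝ᵥ v = 0 := by nlinarith
    exact hv (dotProduct_self_eq_zero.mp h3)
  have hinv : ∀ v : Fin p → ℝ, U⁻¹ *ᵥ (U *ᵥ v) = v := by
    intro v
    rw [mulVec_mulVec, nonsing_inv_mul _ hdet, one_mulVec]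
  have hinv' : ∀ v : Fin p → ℝ, U *ᵥ (U⁻¹ *ᵥ v) = v := by
    intro v
    rw [mulVec_mulVec, mul_nonsing_inv _ hdet, one_mulVec]
  have hmove : ∀ v : Fin p → ℝ, g ⬝ᵥ U⁻¹ *ᵥ v = (U⁻¹ *ᵥ g) ⬝ᵥ v := by
    intro v
    rw [dotProduct_mulVec, ← mulVec_transpose, transpose_nonsing_inv, hsym]
  refine ⟨?_, ?_⟩
  · have h1 : g ⬝ᵥ w = g ⬝ᵥ U⁻¹ *ᵥ (U *ᵥ w) := by rw [hinv]
    rw [h1, hUv, mulVec_add, mulVec_smul, mulVec_smul, dotProduct_add, dotProduct_smul,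
      dotProduct_smul, smul_eq_mul, smul_eq_mul]
    ring
  · have h1 := hq (U⁻¹ *ᵥ g)
    rw [hinv', dotProduct_comm _ g] at h1
    rw [hmove w, ← Real.sqrt_mul (Finset.sum_nonneg fun i _ => sq_nonneg _)]
    apply Real.abs_le_sqrt
    have hcs : ((U⁻¹ *ᵥ g) ⬝ᵥ w) ^ 2 ≤ ((U⁻¹ *ᵥ g) ⬝ᵥ (U⁻¹ *ᵥ g)) * ∑ i, w i ^ 2 := by
      have := Finset.sum_mul_sq_le_sq_mul_sq Finset.univ (U⁻¹ *ᵥ g) w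
      simpa [dotProduct, sq] using this
    have hw : 0 ≤ ∑ i, w i ^ 2 := Finset.sum_nonneg fun i _ => sq_nonneg _
    calc (lam * ((U⁻¹ *ᵥ g) ⬝ᵥ w)) ^ 2 = lam ^ 2 * ((U⁻¹ *ᵥ g) ⬝ᵥ w) ^ 2 := by ring
      _ ≤ lam ^ 2 * (((U⁻¹ *ᵥ g) ⬝ᵥ (U⁻¹ *ᵥ g)) * ∑ i, w i ^ 2) := by gcongr
      _ = (∑ i, w i ^ 2) * (lam * (lam * ((U⁻¹ *ᵥ g) ⬝ᵥ (U⁻¹ *ᵥ g)))) := by ring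
      _ ≤ _ := by gcongr
end

section
/- Let p ≥ 1 and T ≥ 1 be natural numbers, let λ ≥ 1, m > 0, B > 0 be real numbers, and let g₁, …, g_T ∈ ℝ^p. Define U_0 = λ·I_p, U_t = U_{t−1} + (1/m)·g_t g_tᵀ for 1 ≤ t ≤ T, and σ_t² = (λ/m)·g_tᵀ U_{t−1}⁻¹ g_t. Then Σ_{t=1}^{T} min{ σ_t², B } ≤ (λ·B / log(B+1)) · log det( I_p + (1/(mλ))·Σ_{t=1}^{T} g_t g_tᵀ ), where log denotes the natural logarithm. -/
open Matrix Finset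

lemma scalar_aux (lam B x : ℝ) (hlam : 1 ≤ lam) (hB : 0 < B) (hx : 0 ≤ x) :
    min (lam * x) B ≤ lam * B / Real.log (B + 1) * Real.log (1 + x) := by
  have hl : 0 < Real.log (B + 1) := Real.log_pos (by linarith)
  have hlx : 0 ≤ Real.log (1 + x) := Real.log_nonneg (by linarith)
  rw [div_mul_eq_mul_div, le_div_iff₀ hl]
  rcases le_total x B with h | h
  · have h1 : (1 + B) ^ (x / B) ≤ 1 + (x / B) * B :=
      rpow_one_add_le_one_add_mul_self (by linarith) (by positivity)
        ((div_le_one hB).2 h)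
    rw [div_mul_cancel₀ _ hB.ne'] at h1
    have h2 := Real.log_le_log (by positivity) h1
    rw [Real.log_rpow (by linarith), div_mul_eq_mul_div, div_le_iff₀ hB, add_comm 1 B] at h2
    calc min (lam * x) B * Real.log (B + 1) ≤ lam * x * Real.log (B + 1) :=
          mul_le_mul_of_nonneg_right (min_le_left _ _) hl.le
      _ = lam * (x * Real.log (B + 1)) := by ring
      _ ≤ lam * (Real.log (1 + x) * B) := mul_le_mul_of_nonneg_left h2 (by linarith)
      _ = _ := by ring
  · have h2 : Real.log (B + 1) ≤ Real.log (1 + x) :=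
      Real.log_le_log (by linarith) (by linarith)
    calc min (lam * x) B * Real.log (B + 1) ≤ B * Real.log (B + 1) :=
          mul_le_mul_of_nonneg_right (min_le_right _ _) hl.le
      _ ≤ B * Real.log (1 + x) := mul_le_mul_of_nonneg_left h2 hB.le
      _ ≤ lam * (B * Real.log (1 + x)) := le_mul_of_one_le_left (by positivity) hlam
      _ = _ := by ring

/-- Bound on the sum of truncated predictive variances of the NeuralBO algorithm
in terms of the log-determinant of the gram matrix. -/
theorem stmt_15 (p T : ℕ) (hp : 1 ≤ p) (hT : 1 ≤ T) (lam m B : ℝ) (hlam : 1 ≤ lam)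
    (hm : 0 < m) (hB : 0 < B) (g : ℕ → (Fin p → ℝ))
    (U : ℕ → Matrix (Fin p) (Fin p) ℝ)
    (hU0 : U 0 = lam • (1 : Matrix (Fin p) (Fin p) ℝ))
    (hU : ∀ t, U (t + 1) = U t + (1 / m) • vecMulVec (g t) (g t)) :
    ∑ t ∈ Finset.range T, min ((lam / m) * (g t ⬝ᵥ (U t)⁻¹ *ᵥ g t)) B ≤
      (lam * B / Real.log (B + 1)) *
        Real.log (Matrix.det ((1 : Matrix (Fin p) (Fin p) ℝ) +
          (1 / (m * lam)) • ∑ t ∈ Finset.range T, vecMulVec (g t) (g t))) := by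
  have hl0 : 0 < lam := by linarith
  have hpd : ∀ t, (U t).PosDef := by
    intro t
    induction t with
    | zero => rw [hU0]; exact PosDef.one.smul hl0
    | succ t ih =>
      rw [hU]
      refine ih.add_posSemidef (PosSemidef.smul ?_ (by positivity))
      simpa using posSemidef_vecMulVec_self_star (g t)
  have hx : ∀ t, 0 ≤ 1 / m * (g t ⬝ᵥ (U t)⁻¹ *ᵥ g t) := fun t => by
    have := (hpd t).inv.posSemidef.dotProduct_mulVec_nonneg (g t)
    simp only [star_trivial] at this
    positivity
  have hdet : ∀ t, (U (t + 1)).det = (U t).det * (1 + 1 / m * (g t ⬝ᵥ (U t)⁻¹ *ᵥ g t)) := by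
    intro t
    have h := det_add_replicateCol_mul_replicateRow (ι := Unit) (hpd t).det_pos.ne'.isUnit
      ((1 / m) • g t) (g t)
    rw [hU, ← smul_vecMulVec, vecMulVec_eq Unit, h]
    rw [Matrix.mul_assoc, ← replicateCol_mulVec, ← det_one_add_mul_comm,
      det_one_add_replicateCol_mul_replicateRow, mulVec_smul, dotProduct_smul, smul_eq_mul]
  have hUV : ∀ t, U t = lam • ((1 : Matrix (Fin p) (Fin p) ℝ) +
          (1 / (m * lam)) • ∑ t ∈ Finset.range t, vecMulVec (g t) (g t)) := by
    intro t
    induction t with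
    | zero => simp [hU0]
    | succ t ih =>
      rw [hU, ih, Finset.sum_range_succ, smul_add, smul_add, smul_add, smul_add, smul_smul,
        smul_smul, add_assoc]
      congr 3
      field_simp
  have hlog : ∀ t, Real.log (U t).det = Real.log (U 0).det +
      ∑ s ∈ Finset.range t, Real.log (1 + 1 / m * (g s ⬝ᵥ (U s)⁻¹ *ᵥ g s)) := by
    intro t
    induction t with
    | zero => simp
    | succ t ih =>
      rw [hdet, Real.log_mul (hpd t).det_pos.ne' (by linarith [hx t]), ih,
        Finset.sum_range_succ, add_assoc]
  have hfin : Real.log (Matrix.det ((1 : Matrix (Fin p) (Fin p) ℝ) +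
          (1 / (m * lam)) • ∑ t ∈ Finset.range T, vecMulVec (g t) (g t))) =
      ∑ s ∈ Finset.range T, Real.log (1 + 1 / m * (g s ⬝ᵥ (U s)⁻¹ *ᵥ g s)) := by
    have h := hlog T
    have hp' := (hpd T).det_pos
    rw [hUV T, det_smul] at h hp'
    rw [hU0, det_smul, det_one, mul_one, Real.log_mul (by positivity)
      (right_ne_zero_of_mul hp'.ne')] at h
    linarith
  rw [hfin, Finset.mul_sum]
  refine Finset.sum_le_sum fun t _ => ?_
  have := scalar_aux lam B _ hlam hB (hx t)
  rwa [← mul_assoc, mul_one_div] at this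
end
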